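/- Let E ⊂ ℝ^n be nonempty and compact, 0 ≤ s ≤ n and θ ∈ (0,1]. There exist r₀ > 0 and a constant a_n depending only on n with the following property: if 0 < r ≤ r₀ and there exist a Borel probability measure μ supported on E and γ > 0 such that ∫ φ_{r,θ}^{s,n}(x−y) dμ(y) ≥ γ for all x ∈ E, then S_{r,θ}^s(E) ≤ a_n ⌈log₂(|E|/r) + 1⌉ r^s / γ. -/

import Mathlib

open MeasureTheory Metric Set Filter Topology
open scoped ENNReal NNReal

noncomputable section

/-- Euclidean space `ℝ^n`. -/
abbrev Euc (n : ℕ) := EuclideanSpace ℝ (Fin n)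

instance matrixMeasurableSpace (n : ℕ) : MeasurableSpace (Matrix (Fin n) (Fin n) ℝ) :=
  inferInstanceAs (MeasurableSpace (Fin n → Fin n → ℝ))

/-- The restricted covering sum `S_{r,θ}^s(E)`: the infimum of `Σ_i |U_i|^s` over all
countable covers `{U_i}` of `E` with `r ≤ |U_i| ≤ r^θ`, valued in `ℝ≥0∞`. -/
def coverSum (n : ℕ) (E : Set (Euc n)) (θ s r : ℝ) : ℝ≥0∞ :=
  sInf { T : ℝ≥0∞ | ∃ 𝒰 : Set (Set (Euc n)), 𝒰.Countable ∧ E ⊆ ⋃₀ 𝒰 ∧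
    (∀ U ∈ 𝒰, r ≤ diam U ∧ diam U ≤ r ^ θ) ∧
    T = ∑' U : 𝒰, ENNReal.ofReal (diam (U : Set (Euc n)) ^ s) }

/-- Real-valued version of `coverSum`. -/
def Sval (n : ℕ) (E : Set (Euc n)) (θ s r : ℝ) : ℝ := (coverSum n E θ s r).toReal

/-- The quotient `log S_{r,θ}^s(E) / (-log r)`. -/
def Squot (n : ℕ) (E : Set (Euc n)) (θ s r : ℝ) : ℝ :=
  Real.log (Sval n E θ s r) / (-Real.log r)

/-- `N_δ(E)`: the smallest number of sets of diameter at most `δ` needed to cover `E`. -/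
def covNum (n : ℕ) (E : Set (Euc n)) (δ : ℝ) : ℕ :=
  sInf { k : ℕ | ∃ U : Fin k → Set (Euc n), E ⊆ ⋃ i, U i ∧ ∀ i, diam (U i) ≤ δ }

/-- The lower box-counting dimension of `E`. -/
def lowerBoxDim (n : ℕ) (E : Set (Euc n)) : ℝ :=
  liminf (fun δ : ℝ => Real.log (covNum n E δ) / (-Real.log δ)) (𝓝[>] 0)

/-- The upper box-counting dimension of `E`. -/
def upperBoxDim (n : ℕ) (E : Set (Euc n)) : ℝ :=
  limsup (fun δ : ℝ => Real.log (covNum n E δ) / (-Real.log δ)) (𝓝[>] 0)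

/-- The kernel `φ_{r,θ}^{s,m}`. -/
def phiK (n : ℕ) (m s θ r : ℝ) (x : Euc n) : ℝ :=
  if ‖x‖ < r then 1
  else if ‖x‖ < r ^ θ then (r / ‖x‖) ^ s
  else r ^ (θ * (m - s) + s) / ‖x‖ ^ m

/-- The kernel `φ̃_{r,θ}^s`. -/
def phiT (n : ℕ) (s θ r : ℝ) (x : Euc n) : ℝ :=
  if ‖x‖ < r then 1
  else if ‖x‖ ≤ r ^ θ then (r / ‖x‖) ^ s
  else 0

/-- The kernel `φ_r^m(x) = min{1, (r/|x|)^m}`. -/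
def phiB (n : ℕ) (m r : ℝ) (x : Euc n) : ℝ :=
  if ‖x‖ ≤ r then 1 else (r / ‖x‖) ^ m

/-- The energy `∬ φ(x-y) dμ(x)dμ(y)` of a measure with respect to a kernel `φ`. -/
def energy (n : ℕ) (φ : Euc n → ℝ) (μ : Measure (Euc n)) : ℝ :=
  ∫ x, ∫ y, φ (x - y) ∂μ ∂μ

/-- The potential `∫ φ(x-y) dμ(y)` of a measure at `x` with respect to a kernel `φ`. -/
def potential (n : ℕ) (φ : Euc n → ℝ) (μ : Measure (Euc n)) (x : Euc n) : ℝ :=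
  ∫ y, φ (x - y) ∂μ

/-- `μ` is a Borel probability measure supported on `E`. -/
def PMeasOn (n : ℕ) (E : Set (Euc n)) (μ : Measure (Euc n)) : Prop :=
  IsProbabilityMeasure μ ∧ μ Eᶜ = 0

/-- The capacity `C_{r,θ}^{s,m}(E)`: the reciprocal of the infimal energy of Borel
probability measures supported on `E` with respect to the kernel `φ_{r,θ}^{s,m}`. -/
def capacity (n : ℕ) (m s θ r : ℝ) (E : Set (Euc n)) : ℝ :=
  (sInf { e : ℝ | ∃ μ : Measure (Euc n), PMeasOn n E μ ∧ e = energy n (phiK n m s θ r) μ })⁻¹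

/-- The quotient `log C_{r,θ}^{s,m}(E) / (-log r)`. -/
def Cquot (n : ℕ) (m s θ : ℝ) (E : Set (Euc n)) (r : ℝ) : ℝ :=
  Real.log (capacity n m s θ r E) / (-Real.log r)

/-- `d` is the lower intermediate dimension `\underline{dim}_θ E`, i.e. the unique
`s ∈ [0,n]` such that `liminf_{r→0} log S_{r,θ}^s(E) / (-log r) = 0`. -/
def IsLowerInterDim (n : ℕ) (θ : ℝ) (E : Set (Euc n)) (d : ℝ) : Prop :=
  d ∈ Icc (0:ℝ) n ∧ liminf (fun r => Squot n E θ d r) (𝓝[>] 0) = 0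

/-- `d` is the upper intermediate dimension `\overline{dim}_θ E`. -/
def IsUpperInterDim (n : ℕ) (θ : ℝ) (E : Set (Euc n)) (d : ℝ) : Prop :=
  d ∈ Icc (0:ℝ) n ∧ limsup (fun r => Squot n E θ d r) (𝓝[>] 0) = 0

/-- `d` is the lower intermediate dimension profile `\underline{dim}_θ^m E`, i.e. the unique
`s ∈ [0,m]` such that `liminf_{r→0} log C_{r,θ}^{s,m}(E) / (-log r) = s`; for bounded sets the
capacity is that of the closure. -/
def IsLowerDimProfile (n m : ℕ) (θ : ℝ) (E : Set (Euc n)) (d : ℝ) : Prop :=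
  d ∈ Icc (0:ℝ) m ∧ liminf (fun r => Cquot n m d θ (closure E) r) (𝓝[>] 0) = d

/-- `d` is the upper intermediate dimension profile `\overline{dim}_θ^m E`. -/
def IsUpperDimProfile (n m : ℕ) (θ : ℝ) (E : Set (Euc n)) (d : ℝ) : Prop :=
  d ∈ Icc (0:ℝ) m ∧ limsup (fun r => Cquot n m d θ (closure E) r) (𝓝[>] 0) = d

/-- `P` is the matrix of an orthogonal projection of `ℝ^n` onto an `m`-dimensional subspace;
such matrices parametrise the Grassmannian `G(n,m)`. -/
def IsProjMat (n m : ℕ) (P : Matrix (Fin n) (Fin n) ℝ) : Prop :=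
  P.transpose = P ∧ P * P = P ∧ P.rank = m

/-- The orthogonal projection map `π_V` associated to a projection matrix. -/
def projMap (n : ℕ) (P : Matrix (Fin n) (Fin n) ℝ) : Euc n → Euc n :=
  fun x => Matrix.toEuclideanLin P x

/-- `γ` is the natural invariant measure `γ_{n,m}` on the Grassmannian `G(n,m)` (realised as
the space of orthogonal projection matrices of rank `m`): a probability measure supported on
the rank-`m` orthogonal projections and invariant under the action of the orthogonal group. -/
def IsGrassMeasure (n m : ℕ) (γ : Measure (Matrix (Fin n) (Fin n) ℝ)) : Prop :=
  IsProbabilityMeasure γ ∧ γ {P | IsProjMat n m P}ᶜ = 0 ∧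
  ∀ A ∈ Matrix.orthogonalGroup (Fin n) ℝ,
    Measure.map (fun P => A * P * A.transpose) γ = γ

/-- A ball of radius `5R` in `ℝ^n` is covered by at most `(60R/d)^n` balls of diameter `d ≤ R`. -/
theorem exists_cover_closedBall (n : ℕ) (x : Euc n) {d R : ℝ} (hd : 0 < d) (hdR : d ≤ R) :
    ∃ u : Set (Euc n), u.Countable ∧ closedBall x (5 * R) ⊆ ⋃ y ∈ u, closedBall y (d / 2) ∧
      (u.encard : ℝ≥0∞) ≤ ENNReal.ofReal ((60 * R / d) ^ n) := by
  obtain ⟨u, hu, hdisj, hcov⟩ := Vitali.exists_disjoint_subfamily_covering_enlargement_closedBall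
    (closedBall x (5 * R)) id (fun _ => d / 10) (d / 10) (fun _ _ => le_rfl) 5 (by norm_num)
  have hcount : (u.encard : ℝ≥0∞) ≤ ENNReal.ofReal ((60 * R / d) ^ n) := by
    have hsum : ∑' y : u, volume (closedBall (y : Euc n) (d / 10))
        ≤ volume (closedBall x (6 * R)) := by
      refine (tsum_meas_le_meas_iUnion_of_disjoint volume (fun _ => measurableSet_closedBall)
        ?_).trans (measure_mono (iUnion_subset fun y => ?_))
      · exact fun y z hyz => hdisj y.2 z.2 (Subtype.coe_injective.ne hyz)
      · refine closedBall_subset_closedBall' ?_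
        have := mem_closedBall.1 (hu y.2)
        linarith
    have hvol (z : Euc n) {ρ : ℝ} (hρ : 0 ≤ ρ) : volume (closedBall z ρ) =
        ENNReal.ofReal (ρ ^ n) * volume (ball (0 : Euc n) 1) := by
      rw [Measure.addHaar_closedBall _ _ hρ, finrank_euclideanSpace_fin]
    have h1 : volume (ball (0 : Euc n) 1) ≠ 0 := (measure_ball_pos _ _ one_pos).ne'
    have h2 : volume (ball (0 : Euc n) 1) ≠ ⊤ := measure_ball_lt_top.ne
    simp only [hvol _ (show 0 ≤ d / 10 by positivity), hvol x (show 0 ≤ 6 * R by linarith)] at hsum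
    rw [ENNReal.tsum_set_const, ← mul_assoc, ENNReal.mul_le_mul_iff_left h1 h2] at hsum
    have h3 : (60 * R / d) ^ n = (6 * R) ^ n / (d / 10) ^ n := by
      rw [← div_pow]; congr 1; field_simp; ring
    have h4 : (0 : ℝ) < (d / 10) ^ n := by positivity
    rw [h3, ENNReal.ofReal_div_of_pos h4, ENNReal.le_div_iff_mul_le
      (Or.inl (by simpa using h4)) (Or.inl ENNReal.ofReal_ne_top)]
    exact hsum
  refine ⟨u, ?_, fun y hy => ?_, hcount⟩
  · have : u.encard ≠ ⊤ := fun h => by simp [h] at hcount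
    exact (encard_ne_top_iff.1 this).countable
  · obtain ⟨z, hz, hyz⟩ := hcov y hy
    refine mem_iUnion₂.2 ⟨z, hz, ?_⟩
    have := hyz (mem_closedBall_self (by positivity))
    simpa [show (5 : ℝ) * (d / 10) = d / 2 by ring] using this

/-- The kernel `φ_{r,θ}^{s,n}` at distance `t ≥ r`, as a single expression. -/
def phiProfile (n : ℕ) (s θ r t : ℝ) : ℝ := r ^ s * min t (r ^ θ) ^ (n - s) / t ^ n

theorem phiProfile_nonneg (n : ℕ) (s θ : ℝ) {r t : ℝ} (hr : 0 < r) (ht : 0 < t) :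
    0 ≤ phiProfile n s θ r t := by
  have : 0 < min t (r ^ θ) := lt_min ht (by positivity)
  unfold phiProfile
  positivity

theorem phiK_nonneg (n : ℕ) (m s θ : ℝ) {r : ℝ} (hr : 0 < r) (x : Euc n) :
    0 ≤ phiK n m s θ r x := by
  unfold phiK
  split_ifs <;> positivity

theorem phiK_eq_phiProfile (n : ℕ) (s θ : ℝ) {r : ℝ} (hr : 0 < r) {x : Euc n} (hx : r ≤ ‖x‖) :
    phiK n n s θ r x = phiProfile n s θ r ‖x‖ := by
  have h0 : 0 < ‖x‖ := hr.trans_le hx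
  unfold phiK phiProfile
  rw [if_neg hx.not_gt]
  split_ifs with h
  · rw [min_eq_left h.le, Real.div_rpow hr.le h0.le, Real.rpow_sub h0, Real.rpow_natCast]
    field_simp
  · rw [min_eq_right (not_lt.1 h), ← Real.rpow_mul hr.le, ← Real.rpow_add hr, Real.rpow_natCast,
      add_comm]

theorem phiProfile_le_two_pow_mul (n : ℕ) {s : ℝ} (θ : ℝ) (hs : s ≤ n) {r t T : ℝ} (hr : 0 < r)
    (ht : 0 < t) (htT : t ≤ T) (hT : T ≤ 2 * t) :
    phiProfile n s θ r t ≤ 2 ^ n * phiProfile n s θ r T := by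
  have h0 : 0 < min t (r ^ θ) := lt_min ht (by positivity)
  have hT0 : 0 < T := ht.trans_le htT
  have h1 : min t (r ^ θ) ^ (n - s) ≤ min T (r ^ θ) ^ (n - s) :=
    Real.rpow_le_rpow h0.le (min_le_min_right _ htT) (by linarith)
  have h2 : T ^ n ≤ 2 ^ n * t ^ n := by rw [← mul_pow]; gcongr
  have h3 : 0 ≤ min T (r ^ θ) ^ (n - s) := (Real.rpow_nonneg h0.le _).trans h1
  unfold phiProfile
  rw [← mul_div_assoc, div_le_div_iff₀ (by positivity) (by positivity)]
  calc r ^ s * min t (r ^ θ) ^ (n - s) * T ^ n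
      ≤ r ^ s * min T (r ^ θ) ^ (n - s) * (2 ^ n * t ^ n) := by gcongr
    _ = _ := by ring

theorem phiK_le_sum (n : ℕ) {s θ r : ℝ} (hs : s ≤ n) (hr : 0 < r)
    (hrθ : r ≤ r ^ θ) (N : ℕ) {x : Euc n} (hx : ‖x‖ ≤ 2 ^ N * r) :
    phiK n n s θ r x ≤ ∑ k ∈ Finset.range (N + 1), 2 ^ n * phiProfile n s θ r (2 ^ k * r) *
      (if ‖x‖ ≤ 2 ^ k * r then 1 else 0) := by
  have hterm (k : ℕ) : 0 ≤ 2 ^ n * phiProfile n s θ r (2 ^ k * r) *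
      (if ‖x‖ ≤ 2 ^ k * r then 1 else 0) := by
    have := phiProfile_nonneg n s θ hr (t := 2 ^ k * r) (by positivity)
    split_ifs <;> positivity
  classical
  have hex : ∃ k : ℕ, ‖x‖ ≤ 2 ^ k * r := ⟨N, hx⟩
  obtain ⟨k, hk, hmin⟩ : ∃ k, ‖x‖ ≤ 2 ^ k * r ∧ ∀ j < k, ¬ ‖x‖ ≤ 2 ^ j * r :=
    ⟨Nat.find hex, Nat.find_spec hex, fun j hj => Nat.find_min hex hj⟩
  have hkN : k ≤ N := not_lt.1 fun h => hmin N h hx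
  refine le_trans ?_ (Finset.single_le_sum (fun i _ => hterm i)
    (Finset.mem_range.2 (Nat.lt_succ_of_le hkN)))
  simp only [if_pos hk, mul_one]
  rcases lt_or_ge ‖x‖ r with h | h
  · have hk0 : k = 0 := by
      by_contra h0
      exact hmin 0 (Nat.pos_of_ne_zero h0) (by simpa using h.le)
    have h1 : phiProfile n s θ r r = 1 := by
      rw [phiProfile, min_eq_left hrθ, ← Real.rpow_add hr, add_sub_cancel, Real.rpow_natCast,
        div_self (by positivity)]
    simp only [phiK, if_pos h, hk0, pow_zero, one_mul, h1, mul_one]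
    exact one_le_pow₀ one_le_two
  · rw [phiK_eq_phiProfile n s θ hr h]
    refine phiProfile_le_two_pow_mul n θ hs hr (hr.trans_le h) hk ?_
    rcases k with _ | j
    · simp only [pow_zero, one_mul]; linarith
    · have := not_le.1 (hmin j j.lt_succ_self)
      rw [pow_succ]; linarith

/-- Pigeonholing over dyadic scales: a lower bound on the potential at `x` gives a ball around `x`
of large measure. -/
theorem exists_scale_of_le_potential (n : ℕ) {s θ r γ : ℝ} (hs : s ≤ n) (hr : 0 < r)
    (hrθ : r ≤ r ^ θ) (N : ℕ) (μ : Measure (Euc n)) [IsProbabilityMeasure μ] {x : Euc n}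
    (hN : ∀ᵐ y ∂μ, ‖x - y‖ ≤ 2 ^ N * r) (hx : γ ≤ potential n (phiK n n s θ r) μ x) :
    ∃ k < N + 1, γ / (N + 1) ≤
      2 ^ n * phiProfile n s θ r (2 ^ k * r) * μ.real (closedBall x (2 ^ k * r)) := by
  have hint (k : ℕ) : Integrable (fun y => 2 ^ n * phiProfile n s θ r (2 ^ k * r) *
      (closedBall x (2 ^ k * r)).indicator (fun _ => (1 : ℝ)) y) μ :=
    ((integrable_const _).indicator measurableSet_closedBall).const_mul _
  have hle : potential n (phiK n n s θ r) μ x ≤ ∑ k ∈ Finset.range (N + 1),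
      2 ^ n * phiProfile n s θ r (2 ^ k * r) * μ.real (closedBall x (2 ^ k * r)) := by
    calc potential n (phiK n n s θ r) μ x
        ≤ ∫ y, ∑ k ∈ Finset.range (N + 1), 2 ^ n * phiProfile n s θ r (2 ^ k * r) *
            (closedBall x (2 ^ k * r)).indicator (fun _ => (1 : ℝ)) y ∂μ := by
          refine integral_mono_of_nonneg (ae_of_all _ fun y => phiK_nonneg n n s θ hr _)
            (integrable_finsetSum _ fun k _ => hint k) ?_
          filter_upwards [hN] with y hy
          simpa only [indicator, mem_closedBall, dist_comm y x, dist_eq_norm]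
            using phiK_le_sum n hs hr hrθ N hy
      _ = _ := by
          rw [integral_finsetSum _ fun k _ => hint k]
          simp [integral_const_mul, integral_indicator_const, measurableSet_closedBall]
  have hsum : ∑ _k ∈ Finset.range (N + 1), γ / (N + 1) ≤ ∑ k ∈ Finset.range (N + 1),
      2 ^ n * phiProfile n s θ r (2 ^ k * r) * μ.real (closedBall x (2 ^ k * r)) := by
    refine le_trans (le_of_eq ?_) (hx.trans hle)
    simp only [Finset.sum_const, Finset.card_range, nsmul_eq_mul]
    push_cast
    field_simp
  obtain ⟨k, hk, h⟩ := Finset.exists_le_of_sum_le ⟨0, by simp⟩ hsum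
  exact ⟨k, Finset.mem_range.1 hk, h⟩

/-- Bound on the covering sum when every point of `E` is the centre of a ball of large measure. -/
theorem coverSum_le_of_scales (n : ℕ) [NeZero n] {E : Set (Euc n)} {θ s r A M : ℝ} (hr : 0 < r)
    (hrθ : r ≤ r ^ θ) (hA : 0 ≤ A) (μ : Measure (Euc n)) [IsProbabilityMeasure μ]
    (R : Euc n → ℝ) (hrR : ∀ x ∈ E, r ≤ R x) (hRM : ∀ x ∈ E, R x ≤ M)
    (hμ : ∀ x ∈ E, R x ^ n * min (R x) (r ^ θ) ^ (s - n) ≤ A * μ.real (closedBall x (R x))) :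
    coverSum n E θ s r ≤ ENNReal.ofReal (60 ^ n * A) := by
  obtain ⟨t, htE, hdisj, hcov⟩ := Vitali.exists_disjoint_subfamily_covering_enlargement_closedBall
    E id R M hRM 5 (by norm_num)
  have htc : t.Countable := hdisj.countable_of_nonempty_interior fun x hx =>
    ⟨x, ball_subset_interior_closedBall (mem_ball_self (hr.trans_le (hrR x (htE hx))))⟩
  let d : Euc n → ℝ := fun x => min (R x) (r ^ θ)
  have hrd (x) (hx : x ∈ E) : r ≤ d x := le_min (hrR x hx) hrθ
  have hd (x) (hx : x ∈ E) : 0 < d x := hr.trans_le (hrd x hx)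
  have hF (x : Euc n) : ∃ u : Set (Euc n), x ∈ E → u.Countable ∧
      closedBall x (5 * R x) ⊆ ⋃ y ∈ u, closedBall y (d x / 2) ∧
      (u.encard : ℝ≥0∞) ≤ ENNReal.ofReal ((60 * R x / d x) ^ n) := by
    by_cases hx : x ∈ E
    · obtain ⟨u, hu⟩ := exists_cover_closedBall n x (hd x hx) (min_le_left (R x) (r ^ θ))
      exact ⟨u, fun _ => hu⟩
    · exact ⟨∅, fun h => absurd h hx⟩
  choose F hF using hF
  let V : Euc n → Set (Set (Euc n)) := fun x => (fun y => closedBall y (d x / 2)) '' F x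
  have hdiam (x) (hx : x ∈ E) (U) (hU : U ∈ V x) : diam U = d x := by
    obtain ⟨y, -, rfl⟩ := hU
    have := hd x hx
    rw [Metric.diam_closedBall_eq y (by positivity)]
    ring
  have hle : coverSum n E θ s r ≤
      ∑' U : (⋃ x ∈ t, V x), ENNReal.ofReal (diam (U : Set (Euc n)) ^ s) := by
    refine sInf_le ⟨⋃ x ∈ t, V x, htc.biUnion fun x hx => (hF x (htE hx)).1.image _, ?_, ?_, rfl⟩
    · intro x hx
      obtain ⟨z, hz, hxz⟩ := hcov x hx
      have hx' := hxz (mem_closedBall_self (hr.le.trans (hrR x hx)))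
      obtain ⟨y, hy, hxy⟩ := mem_iUnion₂.1 ((hF z (htE hz)).2.1 hx')
      exact ⟨_, mem_iUnion₂.2 ⟨z, hz, y, hy, rfl⟩, hxy⟩
    · intro U hU
      obtain ⟨x, hx, hUx⟩ := mem_iUnion₂.1 hU
      rw [hdiam x (htE hx) U hUx]
      exact ⟨hrd x (htE hx), min_le_right _ _⟩
  have hball (x : t) : ∑' U : V x, ENNReal.ofReal (diam (U : Set (Euc n)) ^ s) ≤
      ENNReal.ofReal (60 ^ n * A) * μ (closedBall (x : Euc n) (R x)) := by
    have hxE := htE x.2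
    have hdx := hd x hxE
    calc ∑' U : V x, ENNReal.ofReal (diam (U : Set (Euc n)) ^ s)
        = ∑' _U : V x, ENNReal.ofReal (d x ^ s) :=
          tsum_congr fun U => by rw [hdiam x hxE U U.2]
      _ = (V x).encard * ENNReal.ofReal (d x ^ s) := ENNReal.tsum_set_const _ _
      _ ≤ ENNReal.ofReal ((60 * R x / d x) ^ n) * ENNReal.ofReal (d x ^ s) := by
          gcongr
          exact (ENat.toENNReal_le.2 (encard_image_le _ _)).trans (hF x hxE).2.2
      _ = ENNReal.ofReal (60 ^ n * (R x ^ n * d x ^ (s - n))) := by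
          rw [← ENNReal.ofReal_mul' (by positivity)]
          congr 1
          rw [Real.rpow_sub hdx, Real.rpow_natCast, div_pow, mul_pow]
          ring
      _ ≤ ENNReal.ofReal (60 ^ n * A * μ.real (closedBall (x : Euc n) (R x))) := by
          rw [mul_assoc]
          exact ENNReal.ofReal_le_ofReal
            (mul_le_mul_of_nonneg_left (hμ x hxE) (by positivity))
      _ = _ := by rw [ENNReal.ofReal_mul (by positivity), ofReal_measureReal]
  calc coverSum n E θ s r
      ≤ ∑' U : (⋃ x ∈ t, V x), ENNReal.ofReal (diam (U : Set (Euc n)) ^ s) := hle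
    _ ≤ ∑' x : t, ∑' U : V x, ENNReal.ofReal (diam (U : Set (Euc n)) ^ s) :=
        ENNReal.tsum_biUnion_le_tsum (fun U : Set (Euc n) => ENNReal.ofReal (diam U ^ s)) t V
    _ ≤ ∑' x : t, ENNReal.ofReal (60 ^ n * A) * μ (closedBall (x : Euc n) (R x)) :=
        ENNReal.tsum_le_tsum hball
    _ = ENNReal.ofReal (60 ^ n * A) * ∑' x : t, μ (closedBall (x : Euc n) (R x)) :=
        ENNReal.tsum_mul_left
    _ ≤ ENNReal.ofReal (60 ^ n * A) * 1 := by
        gcongr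
        refine (tsum_meas_le_meas_iUnion_of_disjoint μ (fun _ => measurableSet_closedBall)
          ?_).trans prob_le_one
        exact fun y z hyz => hdisj y.2 z.2 (Subtype.coe_injective.ne hyz)
    _ = _ := mul_one _

theorem coverSum_zero_dim {E : Set (Euc 0)} (hE : E.Nonempty) (θ s : ℝ) {r : ℝ} (hr : 0 < r) :
    coverSum 0 E θ s r = ⊤ := by
  refine sInf_eq_top.2 ?_
  rintro T ⟨𝒰, -, hcov, hU, -⟩
  obtain ⟨x, hx⟩ := hE
  obtain ⟨U, hU𝒰, -⟩ := hcov hx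
  have := (hU U hU𝒰).1
  rw [diam_subsingleton (subsingleton_of_subsingleton)] at this
  exact absurd this hr.not_ge

/-- If some probability measure on `E` has potential bounded below by `γ`
everywhere on `E`, then `S_{r,θ}^s(E) ≤ a_n ⌈log₂(|E|/r)+1⌉ r^s / γ` for small `r`, where the
constant `a_n` depends only on `n`. -/
theorem statement10 (n : ℕ) :
    ∃ a : ℝ, 0 < a ∧
      ∀ E : Set (Euc n), IsCompact E → E.Nonempty →
        ∀ s : ℝ, 0 ≤ s → s ≤ n → ∀ θ : ℝ, θ ∈ Ioc (0:ℝ) 1 →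
          ∃ r₀ : ℝ, 0 < r₀ ∧ ∀ r : ℝ, 0 < r → r ≤ r₀ →
            ∀ μ : Measure (Euc n), PMeasOn n E μ → ∀ γ : ℝ, 0 < γ →
              (∀ x ∈ E, γ ≤ potential n (phiK n n s θ r) μ x) →
              Sval n E θ s r ≤ a * ((⌈Real.logb 2 (diam E / r) + 1⌉ : ℤ) : ℝ) * r ^ s / γ := by
  refine ⟨120 ^ n, by positivity, fun E hE hne s hs0 hsn θ hθ => ?_⟩
  refine ⟨if diam E = 0 then 1 else min 1 (diam E), ?_, fun r hr hr0 μ hμ γ hγ hpot => ?_⟩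
  · split_ifs with h
    · exact one_pos
    · exact lt_min one_pos (diam_nonneg.lt_of_ne' h)
  have hr1 : r ≤ 1 := by
    split_ifs at hr0
    · exact hr0
    · exact hr0.trans (min_le_left _ _)
  have hlog : 0 ≤ Real.logb 2 (diam E / r) := by
    split_ifs at hr0 with h
    · simp [h]
    · exact Real.logb_nonneg one_lt_two ((one_le_div hr).2 (hr0.trans (min_le_right _ _)))
  have hrθ : r ≤ r ^ θ := by
    simpa using Real.rpow_le_rpow_of_exponent_ge hr hr1 hθ.2
  obtain ⟨N, hN⟩ : ∃ N : ℕ, ⌈Real.logb 2 (diam E / r)⌉ = N :=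
    Int.eq_ofNat_of_zero_le (Int.ceil_nonneg hlog)
  have hceil : ((⌈Real.logb 2 (diam E / r) + 1⌉ : ℤ) : ℝ) = N + 1 := by
    rw [Int.ceil_add_one, hN]; push_cast; rfl
  have hdiam : diam E ≤ 2 ^ N * r := by
    rcases (diam_nonneg (s := E)).eq_or_lt with h | h
    · rw [← h]; positivity
    · have h1 : Real.logb 2 (diam E / r) ≤ N := by
        have := Int.le_ceil (Real.logb 2 (diam E / r))
        rwa [hN] at this
      rw [Real.logb_le_iff_le_rpow one_lt_two (by positivity), Real.rpow_natCast,
        div_le_iff₀ hr] at h1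
      exact h1
  rw [hceil]
  rcases eq_or_ne n 0 with rfl | hn
  · rw [Sval, coverSum_zero_dim hne θ s hr, ENNReal.toReal_top]
    positivity
  have : NeZero n := ⟨hn⟩
  have : IsProbabilityMeasure μ := hμ.1
  have hae : ∀ᵐ y ∂μ, y ∈ E := hμ.2
  have hscale (x : Euc n) : ∃ k : ℕ, x ∈ E → k < N + 1 ∧ γ / (N + 1) ≤
      2 ^ n * phiProfile n s θ r (2 ^ k * r) * μ.real (closedBall x (2 ^ k * r)) := by
    by_cases hx : x ∈ E
    · obtain ⟨k, hk⟩ := exists_scale_of_le_potential n hsn hr hrθ N μ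
        (hae.mono fun y hy => dist_eq_norm x y ▸
          (dist_le_diam_of_mem hE.isBounded hx hy).trans hdiam) (hpot x hx)
      exact ⟨k, fun _ => hk⟩
    · exact ⟨0, fun h => absurd h hx⟩
  choose k hk using hscale
  have hbound := coverSum_le_of_scales n (s := s) (A := 2 ^ n * ((N + 1) * r ^ s / γ))
    (M := 2 ^ N * r) hr hrθ (by positivity) μ (fun x => 2 ^ k x * r)
    (fun x _ => le_mul_of_one_le_left hr.le (one_le_pow₀ one_le_two))
    (fun x hx => by
      have := Nat.le_of_lt_succ (hk x hx).1
      gcongr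
      exact one_le_two) ?_
  · refine ENNReal.toReal_le_of_le_ofReal (by positivity) (hbound.trans_eq ?_)
    congr 1
    rw [show (120 : ℝ) = 60 * 2 by norm_num, mul_pow]
    ring
  · intro x hx
    have h := (hk x hx).2
    set R := 2 ^ k x * r
    have hR : 0 < R := by positivity
    have hm : 0 < min R (r ^ θ) := lt_min hR (by positivity)
    rw [show s - n = -(n - s) by ring, Real.rpow_neg hm.le]
    unfold phiProfile at h
    have hpos : 0 < min R (r ^ θ) ^ (n - s) := by positivity
    generalize min R (r ^ θ) ^ (n - s) = p at *
    generalize μ.real (closedBall x R) = q at *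
    rw [div_le_iff₀ (by positivity)] at h
    have hfac : 0 ≤ R ^ n * p⁻¹ / γ := by positivity
    calc R ^ n * p⁻¹ = (R ^ n * p⁻¹ / γ) * γ := by field_simp
      _ ≤ (R ^ n * p⁻¹ / γ) * (2 ^ n * (r ^ s * p / R ^ n) * q * (N + 1)) := by gcongr
      _ = _ := by field_simp
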